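/- arXiv:2012.01161 — 2 statements merged into one kernel-verified Lean document; each statement's English description precedes it below -/
import Mathlib

section
/- For every α > 0, ∫_{-π/2}^{π/2} sinh(3x/α + π/α) / (cosh(3x/α + π/α) + cos(3 ln(2 cos x)/α)) dx = π·tanh(π/(2α)) - (πα/√3)·Σ_{n=0}^∞ 1/(2 cosh(πα(2n+1)/3) - 1). -/
open Real
open Metric Filter Topology

lemma Complex.im_cot_add_mul_I (p q : ℝ) :
    (Complex.cot (p + q * Complex.I)).im
      = -(Real.sinh (2 * q) / (Real.cosh (2 * q) - Real.cos (2 * p))) := by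
  rw [Complex.cot_eq_cos_div_sin, Complex.cos_add_mul_I, Complex.sin_add_mul_I]
  simp only [← Complex.ofReal_cos, ← Complex.ofReal_sin, ← Complex.ofReal_cosh,
    ← Complex.ofReal_sinh, ← Complex.ofReal_mul]
  rw [Complex.div_im]
  simp only [Complex.normSq_apply, Complex.add_re, Complex.add_im, Complex.sub_re, Complex.sub_im,
    Complex.mul_re, Complex.mul_im, Complex.ofReal_re, Complex.ofReal_im, Complex.I_re,
    Complex.I_im]
  have hc := Real.cosh_sq q
  have hs := Real.sin_sq_add_cos_sq p
  have hden : (Real.sin p * Real.cosh q) * (Real.sin p * Real.cosh q)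
      + (Real.cos p * Real.sinh q) * (Real.cos p * Real.sinh q)
      = (Real.cosh (2 * q) - Real.cos (2 * p)) / 2 := by
    rw [Real.cosh_two_mul, Real.cos_two_mul]
    linear_combination (Real.sin p ^ 2 - 1/2) * hc + (Real.sinh q ^ 2 + 1) * hs
  have hnum : (Real.cos p * Real.cosh q) * (Real.cos p * Real.sinh q)
      + (Real.sin p * Real.sinh q) * (Real.sin p * Real.cosh q) = Real.sinh (2 * q) / 2 := by
    rw [Real.sinh_two_mul]
    linear_combination (Real.sinh q * Real.cosh q) * hs
  simp only [mul_zero, mul_one, sub_zero, add_zero, zero_add, zero_sub]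
  rw [hden, ← sub_div, ← neg_div, ← div_div_div_cancel_right₀ (two_ne_zero' ℝ) (-Real.sinh (2 * q))]
  congr 1
  linear_combination -hnum

lemma hasSum_div_sq_add_sq_of_pos {a : ℝ} (ha : 0 < a) (b : ℝ) :
    HasSum (fun n : ℤ ↦ a / (a ^ 2 + (b + n) ^ 2))
      (π * (Real.sinh (2 * (π * a)) / (Real.cosh (2 * (π * a)) - Real.cos (2 * (π * b))))) := by
  set z : ℂ := b + a * Complex.I with hz
  have hzC : z ∈ Complex.integerComplement := by
    rintro ⟨n, hn⟩
    have := congrArg Complex.im hn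
    simp [hz] at this
    exact ha.ne this
  have hterm (n : ℝ) : (1 / (z + n)).im = -(a / (a ^ 2 + (b + n) ^ 2)) := by
    rw [one_div, Complex.inv_im, Complex.normSq_apply]
    simp [hz]
    ring
  have hpair := (Summable.hasSum_iff (summable_cotTerm hzC)).mpr (cot_series_rep' hzC).symm
  have hpair' := Complex.hasSum_im hpair
  have hre : ∀ n : ℕ, (cotTerm z n).im
      = -(a / (a ^ 2 + (b + ((-(n + 1) : ℤ) : ℝ)) ^ 2) + a / (a ^ 2 + (b + ((n + 1 : ℤ) : ℝ)) ^ 2)) := by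
    intro n
    have h1 := hterm ((-(n + 1) : ℤ) : ℝ)
    have h2 := hterm ((n + 1 : ℤ) : ℝ)
    rw [neg_add, ← h1, ← h2, cotTerm, Complex.add_im]
    push_cast
    ring_nf
  simp only [hre] at hpair'
  have hpair'' := hpair'.neg
  simp only [neg_neg] at hpair''
  have hs1 : Summable fun n : ℕ ↦ a / (a ^ 2 + (b + ((-(n + 1) : ℤ) : ℝ)) ^ 2) :=
    Summable.of_nonneg_of_le (fun n ↦ by positivity)
      (fun n ↦ le_add_of_nonneg_right (by positivity)) hpair''.summable
  have hs2 : Summable fun n : ℕ ↦ a / (a ^ 2 + (b + ((n + 1 : ℤ) : ℝ)) ^ 2) :=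
    Summable.of_nonneg_of_le (fun n ↦ by positivity)
      (fun n ↦ le_add_of_nonneg_left (by positivity)) hpair''.summable
  have key := HasSum.of_add_one_of_neg_add_one (f := fun n : ℤ ↦ a / (a ^ 2 + (b + n) ^ 2))
    hs2.hasSum hs1.hasSum
  convert key using 1
  have hsum := (hs1.hasSum.add hs2.hasSum).unique hpair''
  have h0 := hterm 0
  have hcot : π * (Complex.cot (π * z)).im = (π * Complex.cot (π * z) : ℂ).im := by simp
  have hπz : (π : ℂ) * z = ((π * b : ℝ) : ℂ) + ((π * a : ℝ) : ℂ) * Complex.I := by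
    rw [hz]; push_cast; ring
  rw [Complex.sub_im, ← hcot, hπz, Complex.im_cot_add_mul_I] at hsum
  simp only [Complex.ofReal_zero, add_zero] at h0
  simp only [Int.cast_zero, add_zero]
  linarith

lemma hasSum_poisson (a b : ℝ) :
    HasSum (fun n : ℤ ↦ a / (a ^ 2 + (b + π * (n + 1 / 2)) ^ 2))
      (Real.sinh (2 * a) / (Real.cosh (2 * a) + Real.cos (2 * b))) := by
  have hpos {a : ℝ} (ha : 0 < a) :
      HasSum (fun n : ℤ ↦ a / (a ^ 2 + (b + π * (n + 1 / 2)) ^ 2))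
        (Real.sinh (2 * a) / (Real.cosh (2 * a) + Real.cos (2 * b))) := by
    have h := (hasSum_div_sq_add_sq_of_pos (div_pos ha pi_pos) (b / π + 1 / 2)).div_const π
    rw [mul_div_cancel_left₀ _ pi_ne_zero, mul_div_cancel₀ _ pi_ne_zero,
      show 2 * (π * (b / π + 1 / 2)) = 2 * b + π by field_simp, Real.cos_add_pi,
      sub_neg_eq_add] at h
    have hterm (n : ℤ) : a / (a ^ 2 + (b + π * (n + 1 / 2)) ^ 2)
        = a / π / ((a / π) ^ 2 + (b / π + 1 / 2 + n) ^ 2) / π := by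
      rw [show a ^ 2 + (b + π * (n + 1 / 2)) ^ 2
        = π ^ 2 * ((a / π) ^ 2 + (b / π + 1 / 2 + n) ^ 2) by field_simp; ring]
      have : (a / π) ^ 2 + (b / π + 1 / 2 + n) ^ 2 ≠ 0 := by positivity
      field_simp
    rwa [funext hterm]
  rcases lt_trichotomy a 0 with ha | rfl | ha
  · simpa [neg_div] using (hpos (neg_pos.mpr ha)).neg
  · simp
  · exact hpos ha

lemma one_add_mem_slitPlane_of_mem_closedBall {w : ℂ} (hw : w ∈ closedBall (0 : ℂ) 1)
    (hne : w ≠ -1) : 1 + w ∈ Complex.slitPlane := by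
  left
  rw [mem_closedBall_zero_iff] at hw
  have hn : w.re * w.re + w.im * w.im ≤ 1 := by
    rw [← Complex.normSq_apply, Complex.normSq_eq_norm_sq]
    exact pow_le_one₀ (norm_nonneg _) hw
  by_contra! h
  simp only [Complex.add_re, Complex.one_re] at h
  apply hne
  have him : w.im = 0 := by nlinarith
  exact Complex.ext (by simp; nlinarith) (by simpa using him)

/-- The function `w ↦ i / (log (1 + w) - u)`, extended continuously by `0` at `-1`. -/
noncomputable def logResolvent (u : ℂ) : ℂ → ℂ :=
  Function.update (fun w ↦ Complex.I / (Complex.log (1 + w) - u)) (-1) 0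

lemma logResolvent_of_ne (u : ℂ) {w : ℂ} (hw : w ≠ -1) :
    logResolvent u w = Complex.I / (Complex.log (1 + w) - u) :=
  Function.update_of_ne hw _ _

lemma logResolvent_neg_one (u : ℂ) : logResolvent u (-1) = 0 :=
  Function.update_self _ _ _

lemma logResolvent_zero (u : ℂ) : logResolvent u 0 = -(Complex.I / u) := by
  rw [logResolvent_of_ne u (by norm_num)]
  simp [div_neg]

lemma continuousAt_logResolvent_neg_one (u : ℂ) : ContinuousAt (logResolvent u) (-1) := by
  rw [logResolvent, continuousAt_update_same]
  have h1 : Tendsto (fun w : ℂ ↦ ‖1 + w‖) (𝓝[≠] (-1)) (𝓝[≠] 0) := by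
    refine tendsto_nhdsWithin_iff.mpr ⟨?_, ?_⟩
    · have : Continuous fun w : ℂ ↦ ‖1 + w‖ := by fun_prop
      simpa using (this.tendsto (-1)).mono_left nhdsWithin_le_nhds
    · filter_upwards [self_mem_nhdsWithin] with w hw h0
      exact hw (eq_neg_of_add_eq_zero_right (norm_eq_zero.mp h0))
  have h2 := tendsto_atBot_add_const_right _ (-u.re) (Real.tendsto_log_nhdsNE_zero.comp h1)
  have h3 : Tendsto (fun w : ℂ ↦ Complex.log (1 + w) - u) (𝓝[≠] (-1))
      (Bornology.cobounded ℂ) := by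
    rw [← tendsto_norm_atTop_iff_cobounded]
    refine tendsto_atTop_mono (fun w ↦ Complex.abs_re_le_norm _) ?_
    refine tendsto_abs_atBot_atTop.comp (h2.congr fun w ↦ ?_)
    simp [Complex.log_re, sub_eq_add_neg]
  simpa [div_eq_mul_inv] using (tendsto_inv₀_cobounded.comp h3).const_mul Complex.I

lemma differentiableAt_logResolvent {u w : ℂ} (hw : w ∈ closedBall (0 : ℂ) 1) (hne : w ≠ -1)
    (hu : 1 + w ≠ Complex.exp u) : DifferentiableAt ℂ (logResolvent u) w := by
  have hslit := one_add_mem_slitPlane_of_mem_closedBall hw hne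
  have hlog : Complex.log (1 + w) - u ≠ 0 := by
    intro h
    apply hu
    rw [← sub_eq_zero.mp h, Complex.exp_log (Complex.slitPlane_ne_zero hslit)]
  have hd : DifferentiableAt ℂ (fun w ↦ Complex.I / (Complex.log (1 + w) - u)) w :=
    (differentiableAt_const _).div
      ((DifferentiableAt.clog (by fun_prop) hslit).sub (differentiableAt_const _)) hlog
  refine hd.congr_of_eventuallyEq ?_
  filter_upwards [isOpen_ne.mem_nhds hne] with z hz using logResolvent_of_ne u hz

lemma continuousAt_logResolvent {u w : ℂ} (hw : w ∈ closedBall (0 : ℂ) 1)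
    (hu : 1 + w ≠ Complex.exp u) : ContinuousAt (logResolvent u) w := by
  by_cases hne : w = -1
  · exact hne ▸ continuousAt_logResolvent_neg_one u
  · exact (differentiableAt_logResolvent hw hne hu).continuousAt

lemma neg_one_notMem_ball : (-1 : ℂ) ∉ ball (0 : ℂ) 1 := by simp

lemma circleAverage_logResolvent_of_one_lt {u : ℂ} (hu : 1 < ‖Complex.exp u - 1‖) :
    circleAverage (logResolvent u) 0 1 = -(Complex.I / u) := by
  have hne {w : ℂ} (hw : w ∈ closedBall (0 : ℂ) 1) : 1 + w ≠ Complex.exp u := by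
    intro h
    rw [mem_closedBall_zero_iff, eq_sub_of_add_eq' h] at hw
    exact hu.not_ge hw
  rw [← logResolvent_zero]
  apply circleAverage_of_differentiable_on_off_countable Set.countable_empty
  · rw [abs_one]
    exact fun w hw ↦ (continuousAt_logResolvent hw (hne hw)).continuousWithinAt
  · rw [abs_one, Set.sdiff_empty]
    exact fun w hw ↦ differentiableAt_logResolvent (ball_subset_closedBall hw)
      (fun h ↦ neg_one_notMem_ball (h ▸ hw)) (hne (ball_subset_closedBall hw))

lemma circleAverage_logResolvent_of_lt_one {u : ℂ} (hu0 : u ≠ 0) (him : |u.im| < π)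
    (hu : ‖Complex.exp u - 1‖ < 1) :
    circleAverage (logResolvent u) 0 1
      = Complex.I * Complex.exp u / (Complex.exp u - 1) - Complex.I / u := by
  set p : ℂ := Complex.exp u - 1 with hp
  have h1p : 1 + p = Complex.exp u := by rw [hp]; ring
  have hpball : p ∈ ball (0 : ℂ) 1 := by simpa using hu
  have hp1 : p ≠ -1 := fun h ↦ neg_one_notMem_ball (h ▸ hpball)
  have hlogp : Complex.log (1 + p) = u := by
    rw [h1p, Complex.log_exp (abs_lt.mp him).1 (abs_lt.mp him).2.le]
  have hp0 : p ≠ 0 := by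
    intro h
    apply hu0
    rw [← hlogp, h, add_zero, Complex.log_one]
  have hslitp := one_add_mem_slitPlane_of_mem_closedBall (ball_subset_closedBall hpball) hp1
  -- `Q` is the resolvent with its pole at `p` cancelled
  set Q : ℂ → ℂ := Function.update (fun w ↦ (w - p) * logResolvent u w) p (Complex.I * (1 + p))
    with hQ
  have hQp : Q p = Complex.I * (1 + p) := Function.update_self _ _ _
  have hQne {w : ℂ} (hw : w ≠ p) : Q w = (w - p) * logResolvent u w :=
    Function.update_of_ne hw _ _
  have hQev {w : ℂ} (hw : w ≠ p) : Q =ᶠ[𝓝 w] fun w ↦ (w - p) * logResolvent u w := by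
    filter_upwards [isOpen_ne.mem_nhds hw] with z hz using hQne hz
  have hpole {w : ℂ} (hw : w ≠ p) : 1 + w ≠ Complex.exp u :=
    fun h ↦ hw (eq_sub_of_add_eq' h)
  have hQcp : ContinuousAt Q p := by
    rw [hQ, continuousAt_update_same]
    have hd : HasDerivAt (fun w : ℂ ↦ Complex.log (1 + w)) (1 / (1 + p)) p :=
      ((hasDerivAt_id p).const_add 1).clog hslitp
    have ht := (hd.tendsto_slope.inv₀
      (one_div_ne_zero (Complex.slitPlane_ne_zero hslitp))).const_mul Complex.I
    rw [one_div, inv_inv] at ht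
    refine ht.congr' ?_
    filter_upwards [nhdsWithin_le_nhds (isOpen_ne.mem_nhds hp1)] with w hw
    rw [logResolvent_of_ne u hw, slope_def_field, hlogp, inv_div]
    ring
  have hQc : ContinuousOn Q (closedBall 0 |1|) := by
    rw [abs_one]
    intro w hw
    by_cases hwp : w = p
    · exact hwp ▸ hQcp.continuousWithinAt
    · refine ContinuousAt.continuousWithinAt (ContinuousAt.congr ?_ (hQev hwp).symm)
      exact ContinuousAt.mul (by fun_prop) (continuousAt_logResolvent hw (hpole hwp))
  have hQd : ∀ w ∈ ball (0 : ℂ) |1| \ {p}, DifferentiableAt ℂ Q w := by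
    rw [abs_one]
    rintro w ⟨hw, hwp⟩
    refine DifferentiableAt.congr_of_eventuallyEq ?_ (hQev hwp)
    exact DifferentiableAt.mul (by fun_prop)
      (differentiableAt_logResolvent (ball_subset_closedBall hw)
      (fun h ↦ neg_one_notMem_ball (h ▸ hw)) (hpole hwp))
  have havg0 := circleAverage_of_differentiable_on_off_countable
    (Set.countable_singleton p) hQc hQd
  have havgp := circleAverage_sub_sub_inv_smul_of_differentiable_on_off_countable
    (Set.countable_singleton p) hQc hQd (by rwa [abs_one])
  have hsphere {w : ℂ} (hw : w ∈ sphere (0 : ℂ) |1|) : w ≠ p := by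
    rintro rfl
    rw [abs_one, mem_sphere_zero_iff_norm] at hw
    exact hu.ne hw
  have hsub : sphere (0 : ℂ) |1| ⊆ closedBall 0 |1| := sphere_subset_closedBall
  have hi0 : CircleIntegrable Q 0 1 :=
    ContinuousOn.circleIntegrable' (hQc.mono hsub)
  have hip : CircleIntegrable (fun z ↦ ((z - 0) / (z - p)) • Q z) 0 1 := by
    apply ContinuousOn.circleIntegrable'
    have hquot : ContinuousOn (fun z : ℂ ↦ (z - 0) / (z - p)) (sphere 0 |1|) :=
      ContinuousOn.div (by fun_prop) (by fun_prop) fun w hw ↦ sub_ne_zero.mpr (hsphere hw)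
    exact hquot.smul (hQc.mono hsub)
  have hcongr : Set.EqOn (logResolvent u)
      (fun z ↦ p⁻¹ • (((z - 0) / (z - p)) • Q z - Q z)) (sphere 0 |1|) := by
    intro w hw
    have hwp : w - p ≠ 0 := sub_ne_zero.mpr (hsphere hw)
    simp only [smul_eq_mul, hQne (hsphere hw)]
    field_simp
    ring
  rw [circleAverage_congr_sphere hcongr, circleAverage_fun_smul, circleAverage_fun_sub hip hi0,
    havg0, havgp, hQp, hQne hp0.symm, logResolvent_zero, h1p, smul_eq_mul]
  field_simp
  ring

lemma log_one_add_exp_two_mul_I {x : ℝ} (hx : x ∈ Set.Ioo (-(π / 2)) (π / 2)) :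
    Complex.log (1 + Complex.exp ((2 * x : ℝ) * Complex.I))
      = Real.log (2 * Real.cos x) + x * Complex.I := by
  have hcos : 0 < Real.cos x := Real.cos_pos_of_mem_Ioo hx
  have h : 1 + Complex.exp ((2 * x : ℝ) * Complex.I)
      = Complex.exp (Real.log (2 * Real.cos x) + x * Complex.I) := by
    rw [Complex.exp_add, ← Complex.ofReal_exp, Real.exp_log (by positivity)]
    push_cast
    rw [Complex.two_cos, add_mul, ← Complex.exp_add, ← Complex.exp_add]
    ring_nf
    simp [add_comm]
  rw [h, Complex.log_exp]
  · simp; linarith [hx.1, pi_pos]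
  · simp; linarith [hx.2, pi_pos]

lemma circleAverage_eq_integral_Icc_half_pi (f : ℂ → ℂ) :
    circleAverage f 0 1
      = (π : ℂ)⁻¹ * ∫ x in (-(π / 2))..(π / 2), f (Complex.exp ((2 * x : ℝ) * Complex.I)) := by
  rw [circleAverage]
  have hper : (fun θ ↦ f (circleMap 0 1 θ)).Periodic (2 * π) :=
    fun x ↦ by simp [periodic_circleMap 0 1 x]
  have h := hper.intervalIntegral_add_eq 0 (-π)
  rw [zero_add, show -π + 2 * π = π by ring] at h
  have hmap (x : ℝ) : f (Complex.exp ((2 * x : ℝ) * Complex.I)) = f (circleMap 0 1 (2 * x)) := by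
    simp [circleMap]
  simp only [hmap]
  rw [h, intervalIntegral.integral_comp_mul_left (fun x ↦ f (circleMap 0 1 x)) two_ne_zero,
    show (2 : ℝ) * -(π / 2) = -π by ring, show (2 : ℝ) * (π / 2) = π by ring]
  simp only [Complex.real_smul]
  push_cast
  ring

lemma norm_exp_sub_one_sq (s : ℝ) :
    ‖Complex.exp (-(s + (π / 3 : ℝ) * Complex.I)) - 1‖ ^ 2
      = Real.exp (-s) ^ 2 - Real.exp (-s) + 1 := by
  rw [← Complex.normSq_eq_norm_sq, Complex.normSq_apply]
  simp only [Complex.sub_re, Complex.sub_im, Complex.exp_re, Complex.exp_im]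
  simp
  have := Real.sq_sqrt (show (0 : ℝ) ≤ 3 by norm_num)
  linear_combination (Real.exp (-s)) ^ 2 / 4 * this

lemma re_I_mul_exp_div (s : ℝ) :
    (Complex.I * Complex.exp (-(s + (π / 3 : ℝ) * Complex.I))
        / (Complex.exp (-(s + (π / 3 : ℝ) * Complex.I)) - 1)).re
      = -(√3 / 2 / (2 * Real.cosh s - 1)) := by
  rw [Complex.div_re, ← add_div, Complex.normSq_eq_norm_sq, norm_exp_sub_one_sq]
  simp only [Complex.sub_re, Complex.sub_im, Complex.exp_re, Complex.exp_im, Complex.mul_re,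
    Complex.mul_im]
  simp
  have hE := Real.exp_pos (-s)
  have hcosh : Real.cosh s = (Real.exp (-s) + (Real.exp (-s))⁻¹) / 2 := by
    rw [Real.cosh_eq, ← Real.exp_neg, neg_neg]; ring
  have h1 : 0 < Real.exp (-s) ^ 2 - Real.exp (-s) + 1 := by
    nlinarith [sq_nonneg (Real.exp (-s) - 1)]
  have h2 : 2 * Real.cosh s - 1 = (Real.exp (-s) ^ 2 - Real.exp (-s) + 1) / Real.exp (-s) := by
    rw [hcosh]; field_simp; ring
  rw [h2]
  field_simp
  ring

lemma re_I_div_add_mul_I (y B : ℝ) :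
    (Complex.I / (y + B * Complex.I)).re = B / (B ^ 2 + y ^ 2) := by
  rw [Complex.div_re, Complex.normSq_apply]
  simp
  ring

lemma integral_shifted_log_cos {s : ℝ} (hs : s ≠ 0) :
    ∫ x in (-(π / 2))..(π / 2),
        (x + π / 3) / ((x + π / 3) ^ 2 + (Real.log (2 * Real.cos x) + s) ^ 2)
      = π * ((π / 3) / ((π / 3) ^ 2 + s ^ 2))
        - π * (√3 / 2) * (if 0 < s then 1 / (2 * Real.cosh s - 1) else 0) := by
  set u : ℂ := -(s + (π / 3 : ℝ) * Complex.I) with hu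
  have hEpos := Real.exp_pos (-s)
  have hnorm := norm_exp_sub_one_sq s
  rw [← hu] at hnorm
  have hu0 : u ≠ 0 := by
    intro h
    apply hs
    simpa [hu] using congrArg Complex.re h
  have havg : (circleAverage (logResolvent u) 0 1).re = (π / 3) / ((π / 3) ^ 2 + s ^ 2)
      - √3 / 2 * (if 0 < s then 1 / (2 * Real.cosh s - 1) else 0) := by
    have h0 : (-(Complex.I / u)).re = (π / 3) / ((π / 3) ^ 2 + s ^ 2) := by
      rw [hu, div_neg, neg_neg, re_I_div_add_mul_I]
    rcases hs.lt_or_gt with hneg | hpos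
    · rw [if_neg hneg.not_gt, mul_zero, sub_zero, ← h0,
        circleAverage_logResolvent_of_one_lt]
      have : 1 < Real.exp (-s) := Real.one_lt_exp_iff.mpr (by linarith)
      refine (one_lt_sq_iff₀ (norm_nonneg _)).mp ?_
      nlinarith
    · rw [if_pos hpos, ← h0, circleAverage_logResolvent_of_lt_one hu0, sub_eq_add_neg,
        Complex.add_re, hu, re_I_mul_exp_div s]
      · ring
      · rw [hu]
        simp [abs_of_pos (div_pos pi_pos three_pos)]
        linarith [pi_pos]
      · have : Real.exp (-s) < 1 := by simpa using hpos
        refine (sq_lt_one_iff₀ (norm_nonneg _)).mp ?_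
        nlinarith
  have hi : IntervalIntegrable
      (fun x : ℝ ↦ logResolvent u (Complex.exp ((2 * x : ℝ) * Complex.I))) MeasureTheory.volume
      (-(π / 2)) (π / 2) := by
    apply Continuous.intervalIntegrable
    rw [continuous_iff_continuousAt]
    intro x
    have hmem : Complex.exp ((2 * x : ℝ) * Complex.I) ∈ sphere (0 : ℂ) 1 := by
      rw [mem_sphere_zero_iff_norm, Complex.norm_exp_ofReal_mul_I]
    refine ContinuousAt.comp (continuousAt_logResolvent (sphere_subset_closedBall hmem) ?_)
      (by fun_prop)
    intro h
    rw [mem_sphere_zero_iff_norm, eq_sub_of_add_eq' h] at hmem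
    rw [hmem] at hnorm
    have : Real.exp (-s) = 1 := by nlinarith
    exact hs (by simpa using this)
  rw [circleAverage_eq_integral_Icc_half_pi, ← Complex.ofReal_inv, Complex.re_ofReal_mul,
    inv_mul_eq_iff_eq_mul₀ pi_ne_zero] at havg
  rw [mul_assoc, ← mul_sub, ← havg]
  refine Eq.trans ?_ (intervalIntegral.intervalIntegral_re (𝕜 := ℂ) hi)
  refine intervalIntegral.integral_congr_Ioo_of_le (by linarith [pi_pos]) fun x hx ↦ ?_
  have hlog := log_one_add_exp_two_mul_I hx
  have hne : Complex.exp ((2 * x : ℝ) * Complex.I) ≠ -1 := by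
    intro h
    have hc : Real.cos (2 * x) = -1 := by
      rw [← Complex.exp_ofReal_mul_I_re, h, Complex.neg_re, Complex.one_re]
    have := Real.cos_pos_of_mem_Ioo hx
    rw [Real.cos_two_mul] at hc
    nlinarith
  simp only [RCLike.re_to_complex]
  rw [logResolvent_of_ne u hne, hlog, ← re_I_div_add_mul_I, hu]
  push_cast
  ring_nf

lemma cosh_add_cos_pos {A : ℝ} (hA : A ≠ 0) (B : ℝ) : 0 < Real.cosh A + Real.cos B := by
  linarith [Real.one_lt_cosh.mpr hA, Real.neg_one_le_cos B]

lemma abs_sinh_div_cosh_add_cos_le {A : ℝ} (hA : A ≠ 0) (B : ℝ) :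
    |Real.sinh A / (Real.cosh A + Real.cos B)| ≤ |Real.sinh A| / (Real.cosh A - 1) := by
  rw [abs_div, abs_of_pos (cosh_add_cos_pos hA B)]
  have := Real.one_lt_cosh.mpr hA
  have hB := Real.neg_one_le_cos B
  exact div_le_div_of_nonneg_left (abs_nonneg _) (by linarith) (by linarith)

lemma intervalIntegrable_sinh_div {α : ℝ} (hα : 0 < α) :
    IntervalIntegrable (fun x ↦ Real.sinh (3*x/α + π/α)
      / (Real.cosh (3*x/α + π/α) + Real.cos (3 * Real.log (2 * Real.cos x) / α)))
      MeasureTheory.volume (-(π / 2)) (π / 2) := by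
  set f : ℝ → ℝ := fun x ↦ Real.sinh (3*x/α + π/α)
      / (Real.cosh (3*x/α + π/α) + Real.cos (3 * Real.log (2 * Real.cos x) / α)) with hf
  have hπ := pi_pos
  have hA {x : ℝ} (hx : x ≠ -(π / 3)) : 3*x/α + π/α ≠ 0 := by
    rw [← add_div]
    refine div_ne_zero (fun h ↦ hx ?_) hα.ne'
    linarith
  have hmeas : Measurable f := by fun_prop
  have hpiece {c d : ℝ} (hcd : -(π / 3) ∉ Set.uIcc c d) :
      IntervalIntegrable f MeasureTheory.volume c d := by
    have hx {x : ℝ} (hx : x ∈ Set.uIcc c d) : x ≠ -(π / 3) := fun h ↦ hcd (h ▸ hx)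
    have hdom : IntervalIntegrable
        (fun x ↦ |Real.sinh (3*x/α + π/α)| / (Real.cosh (3*x/α + π/α) - 1))
        MeasureTheory.volume c d := by
      apply ContinuousOn.intervalIntegrable
      refine ContinuousOn.div (by fun_prop) (by fun_prop) fun x hxm ↦ ?_
      exact (sub_pos.mpr (Real.one_lt_cosh.mpr (hA (hx hxm)))).ne'
    refine hdom.mono_fun' hmeas.aestronglyMeasurable ?_
    filter_upwards [MeasureTheory.ae_restrict_mem measurableSet_uIoc] with x hxm
    exact abs_sinh_div_cosh_add_cos_le (hA (hx (Set.uIoc_subset_uIcc hxm))) _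
  have hmid : IntervalIntegrable f MeasureTheory.volume (-(5 * π / 12)) 0 := by
    apply ContinuousOn.intervalIntegrable
    rw [Set.uIcc_of_le (by linarith)]
    have hcos {x : ℝ} (hx : x ∈ Set.Icc (-(5 * π / 12)) 0) : 0 < Real.cos x :=
      Real.cos_pos_of_mem_Ioo ⟨by linarith [hx.1], by linarith [hx.2]⟩
    refine ContinuousOn.div (by fun_prop) ?_ fun x hx ↦ ?_
    · have hlog : ContinuousOn (fun x ↦ Real.log (2 * Real.cos x)) (Set.Icc (-(5 * π / 12)) 0) :=
        ContinuousOn.log (by fun_prop) fun x hx ↦ (mul_pos two_pos (hcos hx)).ne'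
      fun_prop
    · by_cases h : x = -(π / 3)
      · rw [h, Real.cos_neg, Real.cos_pi_div_three,
          show 3 * -(π / 3) / α + π / α = 0 by field_simp; ring]
        norm_num
      · exact (cosh_add_cos_pos (hA h) _).ne'
  refine (hpiece ?_).trans (hmid.trans (hpiece ?_))
  · rw [Set.uIcc_of_le (by linarith), Set.mem_Icc]
    rintro ⟨-, h⟩
    linarith
  · rw [Set.uIcc_of_le (by linarith), Set.mem_Icc]
    rintro ⟨h, -⟩
    linarith

lemma tsum_abs_eq_abs_of_hasSum {ι : Type*} {t : ι → ℝ} {S : ℝ} (h : HasSum t S)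
    (hsign : (∀ n, 0 ≤ t n) ∨ ∀ n, t n ≤ 0) : ∑' n, |t n| = |S| := by
  rcases hsign with ht | ht
  · simp only [abs_of_nonneg (ht _), abs_of_nonneg (h.nonneg ht), h.tsum_eq]
  · simp only [abs_of_nonpos (ht _), abs_of_nonpos (h.nonpos ht), h.neg.tsum_eq]

lemma sinh_two_mul_div_cosh_two_mul_add_one (a : ℝ) :
    Real.sinh (2 * a) / (Real.cosh (2 * a) + 1) = Real.tanh a := by
  have hc := Real.cosh_pos a
  have : Real.cosh (2 * a) + 1 = 2 * Real.cosh a ^ 2 := by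
    rw [Real.cosh_two_mul, Real.sinh_sq]; ring
  rw [this, Real.sinh_two_mul, Real.tanh_eq_sinh_div_cosh]
  field_simp

theorem stmt_15 (α : ℝ) (hα : 0 < α) :
    ∫ x in (-(π/2))..(π/2),
        Real.sinh (3*x/α + π/α)
          / (Real.cosh (3*x/α + π/α) + Real.cos (3 * Real.log (2 * Real.cos x) / α))
      = π * Real.tanh (π/(2*α))
        - (π*α / Real.sqrt 3) * ∑' n : ℕ, 1 / (2 * Real.cosh (π*α*(2*n+1)/3) - 1) := by
  set s : ℤ → ℝ := fun n ↦ π * α * (2 * n + 1) / 3 with hsdef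
  have hπ := pi_pos
  have hs0 (n : ℤ) : s n ≠ 0 := by
    have : (2 * n + 1 : ℝ) ≠ 0 := by exact_mod_cast (by omega : 2 * n + 1 ≠ 0)
    exact div_ne_zero (mul_ne_zero (mul_ne_zero hπ.ne' hα.ne') this) three_ne_zero
  have hexp (B L : ℝ) : HasSum (fun n : ℤ ↦ 2 * α / 3 * (B / (B ^ 2 + (L + s n) ^ 2)))
      (Real.sinh (3 * B / α) / (Real.cosh (3 * B / α) + Real.cos (3 * L / α))) := by
    have h := hasSum_poisson (3 / (2 * α) * B) (3 / (2 * α) * L)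
    have hterm (n : ℤ) : 2 * α / 3 * (B / (B ^ 2 + (L + s n) ^ 2))
        = 3 / (2 * α) * B / ((3 / (2 * α) * B) ^ 2
          + (3 / (2 * α) * L + π * (n + 1 / 2)) ^ 2) := by
      rw [show (3 / (2 * α) * B) ^ 2 + (3 / (2 * α) * L + π * (n + 1 / 2)) ^ 2
        = (3 / (2 * α)) ^ 2 * (B ^ 2 + (L + s n) ^ 2) by simp only [hsdef]; field_simp]
      by_cases h0 : B ^ 2 + (L + s n) ^ 2 = 0
      · simp [h0]
      · field_simp
    rw [funext hterm]
    convert h using 4 <;> field_simp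
  have hshift (x : ℝ) : 3 * (x + π / 3) / α = 3 * x / α + π / α := by field_simp
  have hsum := intervalIntegral.hasSum_integral_of_dominated_convergence
    (μ := MeasureTheory.volume) (a := -(π / 2)) (b := π / 2)
    (F := fun (n : ℤ) (x : ℝ) ↦ 2 * α / 3 * ((x + π / 3)
      / ((x + π / 3) ^ 2 + (Real.log (2 * Real.cos x) + s n) ^ 2)))
    (f := fun x ↦ Real.sinh (3*x/α + π/α)
      / (Real.cosh (3*x/α + π/α) + Real.cos (3 * Real.log (2 * Real.cos x) / α)))
    (fun n x ↦ |2 * α / 3 * ((x + π / 3)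
      / ((x + π / 3) ^ 2 + (Real.log (2 * Real.cos x) + s n) ^ 2))|)
    (fun n ↦ Measurable.aestronglyMeasurable (by fun_prop))
    (fun n ↦ .of_forall fun x _ ↦ le_rfl)
    (.of_forall fun x _ ↦ (hexp (x + π / 3) (Real.log (2 * Real.cos x))).summable.abs)
    ?_ ?_
  · simp only [intervalIntegral.integral_const_mul, integral_shifted_log_cos (hs0 _)] at hsum
    have hmain := (hexp (π / 3) 0).mul_left π
    rw [mul_zero, zero_div, Real.cos_zero, show 3 * (π / 3) / α = 2 * (π / (2 * α)) by field_simp,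
      sinh_two_mul_div_cosh_two_mul_add_one] at hmain
    set I := ∫ x in (-(π/2))..(π/2), Real.sinh (3*x/α + π/α)
          / (Real.cosh (3*x/α + π/α) + Real.cos (3 * Real.log (2 * Real.cos x) / α))
    have h3 : √3 ^ 2 = 3 := Real.sq_sqrt (by norm_num)
    have hcoef : π * α / √3 = 2 * α / 3 * (π * (√3 / 2)) := by
      field_simp
      rw [h3]
    have hdiff : HasSum (fun n : ℤ ↦ if 0 < s n then 1 / (2 * Real.cosh (s n) - 1) else 0)
        ((π * Real.tanh (π / (2 * α)) - I) / (π * α / √3)) := by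
      have hterm (n : ℤ) : (if 0 < s n then 1 / (2 * Real.cosh (s n) - 1) else 0)
          = (π * (2 * α / 3 * (π / 3 / ((π / 3) ^ 2 + (0 + s n) ^ 2)))
            - 2 * α / 3 * (π * (π / 3 / ((π / 3) ^ 2 + s n ^ 2))
              - π * (√3 / 2) * (if 0 < s n then 1 / (2 * Real.cosh (s n) - 1) else 0)))
            / (π * α / √3) := by
        rw [zero_add]
        generalize (if 0 < s n then 1 / (2 * Real.cosh (s n) - 1) else 0) = c
        rw [eq_div_iff (by positivity)]
        rw [hcoef]
        ring
      rw [funext hterm]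
      exact (hmain.sub hsum).div_const _
    rw [← Function.Injective.hasSum_iff (g := ((↑) : ℕ → ℤ)) Nat.cast_injective] at hdiff
    · have hnat (n : ℕ) : (if 0 < s n then 1 / (2 * Real.cosh (s n) - 1) else 0)
          = 1 / (2 * Real.cosh (π * α * (2 * n + 1) / 3) - 1) := by
        rw [if_pos (by simp only [hsdef]; push_cast; positivity)]
        simp [hsdef]
      have htsum := (tsum_congr hnat).symm.trans hdiff.tsum_eq
      rw [htsum]
      field_simp
      ring
    · intro n hn
      have hneg : n < 0 := by
        by_contra! h
        exact hn ⟨n.toNat, Int.toNat_of_nonneg h⟩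
      have : (2 * n + 1 : ℝ) ≤ 0 := by exact_mod_cast (by omega : 2 * n + 1 ≤ 0)
      refine if_neg (not_lt.mpr ?_)
      exact div_nonpos_of_nonpos_of_nonneg
        (mul_nonpos_of_nonneg_of_nonpos (by positivity) this) three_pos.le
  · refine (intervalIntegrable_sinh_div hα).abs.congr fun x _ ↦ ?_
    have h := hexp (x + π / 3) (Real.log (2 * Real.cos x))
    rw [hshift x] at h
    have hc (n : ℤ) : 0 ≤ 2 * α / 3 * (1 / ((x + π / 3) ^ 2
        + (Real.log (2 * Real.cos x) + s n) ^ 2)) := by positivity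
    refine (tsum_abs_eq_abs_of_hasSum h ?_).symm
    rcases le_total 0 (x + π / 3) with hy | hy
    · exact .inl fun n ↦ by positivity
    · refine .inr fun n ↦ ?_
      have := mul_nonpos_of_nonneg_of_nonpos (hc n) hy
      rw [show 2 * α / 3 * ((x + π / 3) / ((x + π / 3) ^ 2
        + (Real.log (2 * Real.cos x) + s n) ^ 2)) = 2 * α / 3 * (1 / ((x + π / 3) ^ 2
        + (Real.log (2 * Real.cos x) + s n) ^ 2)) * (x + π / 3) by ring]
      exact this
  · refine .of_forall fun x _ ↦ ?_
    have := hexp (x + π / 3) (Real.log (2 * Real.cos x))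
    rwa [hshift x] at this
end

section
/- For every α ≠ 0, ∫_0^π sinh(x/α) / (cosh(x/α) + cos(ln(2 sin x)/α)) dx = π·tanh(π/(4α)). -/
open Real

open Complex Metric MeasureTheory Filter Topology in
lemma circleAverage_mul_sq_norm_div {f : ℂ → ℂ}
    (hf : DiffContOnCl ℂ (fun z ↦ (1 - z) ^ 2 * f z) (ball 0 1)) {ρ : ℝ} (h0 : 0 < ρ)
    (h1 : ρ < 1) :
    CircleIntegrable (fun z ↦ (((‖1 - z‖ / ‖1 - ρ * z‖) ^ 2 : ℝ) : ℂ) * f z) 0 1 ∧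
    circleAverage (fun z ↦ (((‖1 - z‖ / ‖1 - ρ * z‖) ^ 2 : ℝ) : ℂ) * f z) 0 1
      = ρ⁻¹ * (f 0 - (1 - ρ) / (1 + ρ) * f ρ) := by
  have hne : ∀ z : ℂ, ‖z‖ ≤ 1 → 1 - ρ * z ≠ 0 := by
    intro z hz h
    have h2 : ‖(ρ : ℂ) * z‖ = 1 := by rw [← sub_eq_zero.1 h]; simp
    rw [norm_mul, Complex.norm_real, Real.norm_of_nonneg h0.le] at h2
    nlinarith
  have hρ : (ρ : ℂ) ≠ 0 := by exact_mod_cast h0.ne'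
  set G : ℂ → ℂ := fun z ↦ (1 - ρ * z)⁻¹ • ((1 - z) ^ 2 * f z) with hG
  have hGd : DiffContOnCl ℂ G (ball 0 1) := by
    refine DiffContOnCl.smul (DiffContOnCl.inv ?_ ?_) hf
    · exact Differentiable.diffContOnCl (by fun_prop)
    · intro z hz
      rw [closure_ball _ one_ne_zero, mem_closedBall_zero_iff] at hz
      exact hne z hz
  have hρb : (ρ : ℂ) ∈ ball (0 : ℂ) |1| := by simp [abs_of_pos h0, h1]
  have hGd' : DiffContOnCl ℂ G (ball 0 |1|) := by simpa using hGd
  have A := hGd'.circleAverage_smul_div hρb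
  have B := hGd'.circleAverage_smul_div (w := 0) (by simp)
  have hGc : ContinuousOn G (sphere 0 1) := by
    refine hGd.2.mono ?_
    rw [closure_ball _ one_ne_zero]; exact sphere_subset_closedBall
  have hsub : ∀ w : ℂ, ‖w‖ < 1 → ∀ z ∈ sphere (0 : ℂ) 1, z - w ≠ 0 := by
    intro w hw z hz h
    rw [mem_sphere_zero_iff_norm, sub_eq_zero.1 h] at hz
    linarith
  have hi : ∀ w : ℂ, ‖w‖ < 1 → CircleIntegrable (fun z ↦ ((z - 0) / (z - w)) • G z) 0 1 := by
    intro w hw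
    refine ContinuousOn.circleIntegrable zero_le_one ?_
    exact ContinuousOn.smul (ContinuousOn.div (by fun_prop) (by fun_prop) (hsub w hw)) hGc
  have i0 := hi 0 (by simp)
  have iρ := hi ρ (by simpa using hρb)
  have key : Set.EqOn (fun z ↦ (ρ : ℂ)⁻¹ • (((z - 0) / (z - 0)) • G z - ((z - 0) / (z - ρ)) • G z))
      (fun z ↦ (((‖1 - z‖ / ‖1 - ρ * z‖) ^ 2 : ℝ) : ℂ) * f z) (sphere 0 |1|) := by
    intro z hz
    rw [abs_one] at hz
    have hz0 := hsub 0 (by simp) z hz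
    have hzρ := hsub ρ (by simpa using hρb) z hz
    rw [mem_sphere_zero_iff_norm] at hz
    have h1ρ := hne z hz.le
    have hc : z * (starRingEnd ℂ) z = 1 := by
      rw [Complex.mul_conj, Complex.normSq_eq_norm_sq, hz]; simp
    have e1 : ((‖1 - z‖ ^ 2 : ℝ) : ℂ) * z = -(1 - z) ^ 2 := by
      rw [← Complex.normSq_eq_norm_sq, ← Complex.mul_conj]
      simp only [map_sub, map_one]
      linear_combination (z - 1) * hc
    have e2 : ((‖1 - ρ * z‖ ^ 2 : ℝ) : ℂ) * z = (1 - ρ * z) * (z - ρ) := by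
      rw [← Complex.normSq_eq_norm_sq, ← Complex.mul_conj]
      simp only [map_sub, map_one, map_mul, Complex.conj_ofReal]
      linear_combination (-ρ * (1 - ρ * z)) * hc
    have hN : ((‖1 - ρ * z‖ ^ 2 : ℝ) : ℂ) ≠ 0 := by
      exact_mod_cast pow_ne_zero 2 (norm_ne_zero_iff.2 h1ρ)
    beta_reduce
    rw [div_pow, ofReal_div]
    have : ((‖1 - z‖ ^ 2 : ℝ) : ℂ) / ((‖1 - ρ * z‖ ^ 2 : ℝ) : ℂ)
        = -(1 - z) ^ 2 / ((1 - ρ * z) * (z - ρ)) := by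
      rw [← e1, ← e2]
      simp only [sub_zero] at hz0
      field_simp
    rw [this]
    simp only [hG, smul_eq_mul]
    simp only [sub_zero] at *
    field_simp
    ring
  have I := (i0.sub iρ).const_smul (a := (ρ : ℂ)⁻¹)
  constructor
  · exact (circleIntegrable_congr key).1 I
  · rw [← circleAverage_congr_sphere key, circleAverage_fun_smul, circleAverage_fun_sub i0 iρ, A, B]
    have : (1 + ρ : ℂ) ≠ 0 := by exact_mod_cast (by positivity : (1 + ρ) ≠ 0)
    have : (1 - ρ : ℂ) ≠ 0 := by simpa using hne 1 (by simp)
    have h2 : (1 - ρ * ρ : ℂ) = (1 - ρ) * (1 + ρ) := by ring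
    simp only [hG, smul_eq_mul, h2, Complex.ofReal_inv]
    field_simp
    ring

open Complex Metric MeasureTheory Filter Topology in
/-- Mean value property for functions whose boundary values have nonnegative real part away from a
singularity at `1`; the radial growth condition excludes a point mass there. -/
theorem integral_re_circleMap_of_nonneg {f : ℂ → ℂ}
    (hf : DiffContOnCl ℂ (fun z ↦ (1 - z) ^ 2 * f z) (ball 0 1))
    (hpos : ∀ z : ℂ, ‖z‖ = 1 → z ≠ 1 → 0 ≤ (f z).re)
    (hrad : Tendsto (fun ρ : ℝ ↦ (1 - ρ) * (f ρ).re) (𝓝[<] 1) (𝓝 0)) :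
    ∫ θ in (0 : ℝ)..2 * π, (f (circleMap 0 1 θ)).re = 2 * π * (f 0).re := by
  set W : ℝ → ℂ → ℝ := fun ρ z ↦ (‖1 - z‖ / ‖1 - ρ * z‖) ^ 2 with hW
  set F : ℝ → ℝ → ℝ := fun ρ θ ↦ W ρ (circleMap 0 1 θ) * (f (circleMap 0 1 θ)).re with hF
  have hint : ∀ ρ : ℝ, 0 < ρ → ρ < 1 → IntervalIntegrable (F ρ) volume 0 (2 * π) ∧
      ∫ θ in (0 : ℝ)..2 * π, F ρ θ
        = 2 * π * (ρ⁻¹ * ((f 0).re - (1 + ρ)⁻¹ * ((1 - ρ) * (f ρ).re))) := by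
    intro ρ h0 h1
    obtain ⟨hI, hA⟩ := circleAverage_mul_sq_norm_div hf h0 h1
    have hre : ∀ θ, F ρ θ = RCLike.re ((W ρ (circleMap 0 1 θ) : ℂ) * f (circleMap 0 1 θ)) := by
      intro θ
      simp [hF]
    have hI' : IntervalIntegrable
      (fun θ ↦ (W ρ (circleMap 0 1 θ) : ℂ) * f (circleMap 0 1 θ)) volume 0 (2 * π) := hI
    constructor
    · rw [funext hre]
      exact ⟨hI'.1.re, hI'.2.re⟩
    · rw [funext hre, intervalIntegral.intervalIntegral_re hI']
      rw [circleAverage_def, inv_smul_eq_iff₀ (by positivity)] at hA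
      rw [hA, Complex.real_smul]
      have : ((ρ⁻¹ : ℝ) : ℂ) * (f 0 - (1 - ρ) / (1 + ρ) * f ρ)
          = ((ρ⁻¹ : ℝ) : ℂ) * (f 0 - ((1 + ρ)⁻¹ * (1 - ρ) : ℝ) * f ρ) := by
        push_cast; ring
      simp only [this, RCLike.re_to_complex, Complex.re_ofReal_mul, Complex.sub_re]
      ring
  obtain ⟨ρ, -, hρ, hlim⟩ := exists_seq_strictMono_tendsto' (zero_lt_one' ℝ)
  have hlim' : Tendsto ρ atTop (𝓝[<] 1) :=
    tendsto_nhdsWithin_iff.2 ⟨hlim, .of_forall fun n ↦ (hρ n).2⟩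
  have hval : Tendsto (fun n ↦ ∫ θ in (0 : ℝ)..2 * π, F (ρ n) θ) atTop (𝓝 (2 * π * (f 0).re)) := by
    simp only [fun n ↦ (hint _ (hρ n).1 (hρ n).2).2]
    have h := ((hlim.inv₀ one_ne_zero).mul (tendsto_const_nhds (x := (f 0).re) |>.sub
      (((hlim.const_add 1).inv₀ (by norm_num)).mul (hrad.comp hlim')))).const_mul (2 * π)
    simpa using h
  have h2π : (0 : ℝ) ≤ 2 * π := by positivity
  have hne : ∀ θ ∈ Set.Ioo 0 (2 * π), circleMap 0 1 θ ≠ 1 := by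
    intro θ hθ h
    have : θ ∈ Set.Ico 0 (2 * π) := ⟨hθ.1.le, hθ.2⟩
    have h0 : circleMap 0 1 θ = circleMap 0 1 0 := by rw [h]; simp [circleMap]
    have := (injOn_circleMap_of_abs_sub_le' one_ne_zero (a := 0) (b := 2 * π) (by simp))
      this ⟨le_rfl, by positivity⟩ h0
    exact hθ.1.ne' this
  have hnorm : ∀ θ, ‖circleMap 0 1 θ‖ = 1 := by simp
  have hW0 : ∀ ρ z, 0 ≤ W ρ z := fun ρ z ↦ by positivity
  have hW4 : ∀ ρ : ℝ, 0 < ρ → ρ < 1 → ∀ z : ℂ, ‖z‖ = 1 → W ρ z ≤ 4 := by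
    intro ρ h0 h1 z hz
    have e1 : ‖1 - z‖ ≤ ‖1 - ρ * z‖ + (1 - ρ) := by
      calc ‖1 - z‖ = ‖(1 - ρ * z) - ((1 - ρ : ℝ) : ℂ) * z‖ := by congr 1; push_cast; ring
        _ ≤ _ := norm_sub_le _ _
        _ = _ := by rw [norm_mul, hz, Complex.norm_real, Real.norm_of_nonneg (by linarith), mul_one]
    have e2 : 1 - ρ ≤ ‖1 - ρ * z‖ := by
      calc 1 - ρ = ‖(1 : ℂ)‖ - ‖ρ * z‖ := by
            rw [norm_mul, hz, Complex.norm_real, Real.norm_of_nonneg h0.le]; simp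
        _ ≤ _ := norm_sub_norm_le _ _
    have : ‖1 - z‖ / ‖1 - ρ * z‖ ≤ 2 := by
      rw [div_le_iff₀ (by linarith)]; linarith
    calc W ρ z ≤ 2 ^ 2 := by simp only [hW]; gcongr
      _ = 4 := by norm_num
  have hWlim : ∀ z : ℂ, z ≠ 1 → Tendsto (fun n ↦ W (ρ n) z) atTop (𝓝 1) := by
    intro z hz
    have hz' : ‖1 - z‖ ≠ 0 := norm_ne_zero_iff.2 (sub_ne_zero.2 hz.symm)
    have hc : Tendsto (fun n ↦ (ρ n : ℂ)) atTop (𝓝 ((1 : ℝ) : ℂ)) :=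
      (Complex.continuous_ofReal.tendsto 1).comp hlim
    have h := ((tendsto_const_nhds (x := ‖1 - z‖)).div
      ((tendsto_const_nhds (x := (1 : ℂ))).sub (hc.mul_const z)).norm (by simpa using hz')).pow 2
    simpa [hW, hz'] using h
  simp only [intervalIntegral.integral_of_le h2π, integral_Ioc_eq_integral_Ioo] at hval ⊢
  have hae : ∀ {p : ℝ → Prop}, (∀ θ ∈ Set.Ioo 0 (2 * π), p θ) →
      ∀ᵐ θ ∂(volume.restrict (Set.Ioo 0 (2 * π))), p θ := fun h ↦
    ae_restrict_of_forall_mem measurableSet_Ioo h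
  have hIn : ∀ n, IntegrableOn (F (ρ n)) (Set.Ioo 0 (2 * π)) := fun n ↦
    ((intervalIntegrable_iff_integrableOn_Ioo_of_le h2π).1 (hint _ (hρ n).1 (hρ n).2).1)
  have hFlim : ∀ᵐ θ ∂(volume.restrict (Set.Ioo 0 (2 * π))),
      Tendsto (fun n ↦ F (ρ n) θ) atTop (𝓝 (f (circleMap 0 1 θ)).re) :=
    hae fun θ hθ ↦ by simpa using (hWlim _ (hne θ hθ)).mul_const (f (circleMap 0 1 θ)).re
  have hu : IntegrableOn (fun θ ↦ (f (circleMap 0 1 θ)).re) (Set.Ioo 0 (2 * π)) := by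
    refine integrable_of_tendsto hFlim (fun n ↦ (hIn n).1) ?_
    have : ∀ n, ∫⁻ θ in Set.Ioo 0 (2 * π), ‖F (ρ n) θ‖ₑ
        = ENNReal.ofReal (∫ θ in Set.Ioo 0 (2 * π), F (ρ n) θ) := by
      intro n
      rw [ofReal_integral_eq_lintegral_ofReal (hIn n)
        (hae fun θ hθ ↦ mul_nonneg (hW0 _ _) (hpos _ (hnorm θ) (hne θ hθ)))]
      refine setLIntegral_congr_fun measurableSet_Ioo fun θ hθ ↦ ?_
      exact Real.enorm_of_nonneg (mul_nonneg (hW0 _ _) (hpos _ (hnorm θ) (hne θ hθ)))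
    simp only [this]
    rw [(ENNReal.tendsto_ofReal hval).liminf_eq]
    exact ENNReal.ofReal_ne_top
  refine tendsto_nhds_unique (tendsto_integral_of_dominated_convergence
    (fun θ ↦ 4 * (f (circleMap 0 1 θ)).re) (fun n ↦ (hIn n).1) (hu.const_mul 4)
    (fun n ↦ hae fun θ hθ ↦ ?_) hFlim) hval
  have hp := hpos _ (hnorm θ) (hne θ hθ)
  rw [Real.norm_of_nonneg (mul_nonneg (hW0 _ _) hp)]
  exact mul_le_mul_of_nonneg_right (hW4 _ (hρ n).1 (hρ n).2 _ (hnorm θ)) hp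

lemma Complex.cosh_ofReal_add_mul_I (x y : ℝ) : Complex.cosh (x + y * Complex.I)
    = (Real.cosh x * Real.cos y : ℝ) + (Real.sinh x * Real.sin y : ℝ) * Complex.I := by
  rw [Complex.cosh_add, Complex.cosh_mul_I, Complex.sinh_mul_I]
  push_cast
  ring

lemma Complex.sinh_ofReal_add_mul_I (x y : ℝ) : Complex.sinh (x + y * Complex.I)
    = (Real.sinh x * Real.cos y : ℝ) + (Real.cosh x * Real.sin y : ℝ) * Complex.I := by
  rw [Complex.sinh_add, Complex.cosh_mul_I, Complex.sinh_mul_I]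
  push_cast
  ring

lemma Complex.normSq_cosh_add_mul_I (x y : ℝ) :
    Complex.normSq (Complex.cosh (x + y * Complex.I)) = Real.sinh x ^ 2 + Real.cos y ^ 2 := by
  rw [Complex.cosh_ofReal_add_mul_I, Complex.normSq_add_mul_I]
  linear_combination Real.cos y ^ 2 * Real.cosh_sq x
    + Real.sinh x ^ 2 * Real.sin_sq_add_cos_sq y

lemma Complex.normSq_sinh_add_mul_I (x y : ℝ) :
    Complex.normSq (Complex.sinh (x + y * Complex.I)) = Real.sinh x ^ 2 + Real.sin y ^ 2 := by
  rw [Complex.sinh_ofReal_add_mul_I, Complex.normSq_add_mul_I]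
  linear_combination Real.sin y ^ 2 * Real.cosh_sq x
    + Real.sinh x ^ 2 * Real.sin_sq_add_cos_sq y

lemma Complex.cosh_ne_zero_of_re_pos {w : ℂ} (hw : 0 < w.re) : Complex.cosh w ≠ 0 := by
  rw [← Complex.normSq_pos, ← Complex.re_add_im w, Complex.normSq_cosh_add_mul_I]
  have := Real.sinh_pos_iff.2 hw
  positivity

lemma Complex.re_tanh_add_mul_I (x y : ℝ) :
    (Complex.tanh (x + y * Complex.I)).re
      = Real.sinh (2 * x) / (Real.cosh (2 * x) + Real.cos (2 * y)) := by
  rw [Complex.tanh_eq_sinh_div_cosh, Complex.div_re, Complex.normSq_cosh_add_mul_I, ← add_div]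
  have hd : Real.cosh (2 * x) + Real.cos (2 * y) = 2 * (Real.sinh x ^ 2 + Real.cos y ^ 2) := by
    rw [Real.cosh_two_mul, Real.cos_two_mul, Real.cosh_sq]; ring
  have hn : (Complex.sinh (x + y * Complex.I)).re * (Complex.cosh (x + y * Complex.I)).re
      + (Complex.sinh (x + y * Complex.I)).im * (Complex.cosh (x + y * Complex.I)).im
      = Real.sinh x * Real.cosh x := by
    rw [Complex.sinh_ofReal_add_mul_I, Complex.cosh_ofReal_add_mul_I]
    simp only [Complex.add_re, Complex.add_im, Complex.ofReal_re, Complex.ofReal_im,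
      Complex.re_ofReal_mul, Complex.im_ofReal_mul, Complex.I_re, Complex.I_im]
    linear_combination Real.sinh x * Real.cosh x * Real.sin_sq_add_cos_sq y
  rw [hn, hd, Real.sinh_two_mul, mul_assoc, mul_div_mul_left _ _ two_ne_zero]

lemma Complex.norm_tanh_le {w : ℂ} (hw : 0 < w.re) : ‖Complex.tanh w‖ ≤ Real.cosh w.re / w.re := by
  have hs : ‖Complex.sinh w‖ ≤ Real.cosh w.re := by
    refine le_of_sq_le_sq ?_ (Real.cosh_pos _).le
    rw [← Complex.normSq_eq_norm_sq, Real.cosh_sq]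
    conv_lhs => rw [← Complex.re_add_im w, Complex.normSq_sinh_add_mul_I]
    gcongr
    exact Real.sin_sq_le_one _
  have hc : w.re ≤ ‖Complex.cosh w‖ := by
    refine (Real.self_le_sinh_iff.2 hw.le).trans ?_
    refine le_of_sq_le_sq ?_ (norm_nonneg _)
    rw [← Complex.normSq_eq_norm_sq]
    conv_rhs => rw [← Complex.re_add_im w, Complex.normSq_cosh_add_mul_I]
    exact le_add_of_nonneg_right (sq_nonneg _)
  rw [Complex.tanh_eq_sinh_div_cosh, norm_div]
  exact div_le_div₀ (Real.cosh_pos _).le hs hw hc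

lemma Complex.one_sub_re_pos {z : ℂ} (hz : ‖z‖ ≤ 1) (h1 : z ≠ 1) : 0 < (1 - z).re := by
  have hp : 0 < Complex.normSq (1 - z) := Complex.normSq_pos.2 (sub_ne_zero.2 h1.symm)
  have hq : Complex.normSq z ≤ 1 := by
    rw [Complex.normSq_eq_norm_sq]; exact pow_le_one₀ (norm_nonneg _) hz
  rw [Complex.normSq_apply] at hp hq
  simp at hp ⊢
  nlinarith

lemma Complex.half_norm_le_pi_div_two_add_arg {z : ℂ} (hz : ‖z‖ ≤ 1) (h1 : z ≠ 1) :
    ‖1 - z‖ / 2 ≤ π / 2 + Complex.arg (1 - z) ∧ π / 2 + Complex.arg (1 - z) ≤ π := by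
  have hre := Complex.one_sub_re_pos hz h1
  have habs := abs_le.1 (Complex.abs_arg_le_pi_div_two_iff.2 hre.le)
  have hne : 1 - z ≠ 0 := sub_ne_zero.2 h1.symm
  have hq : Complex.normSq z ≤ 1 := by
    rw [Complex.normSq_eq_norm_sq]; exact pow_le_one₀ (norm_nonneg _) hz
  refine ⟨?_, by linarith⟩
  have h2 : ‖1 - z‖ ^ 2 ≤ 2 * (1 - z).re := by
    rw [← Complex.normSq_eq_norm_sq]
    rw [Complex.normSq_apply] at hq ⊢
    simp
    nlinarith
  calc ‖1 - z‖ / 2 ≤ (1 - z).re / ‖1 - z‖ := by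
        rw [le_div_iff₀ (norm_pos_iff.2 hne)]; linarith
    _ = Real.cos (Complex.arg (1 - z)) := (Complex.cos_arg hne).symm
    _ = Real.sin (π / 2 + Complex.arg (1 - z)) := by rw [add_comm, Real.sin_add_pi_div_two]
    _ ≤ _ := Real.sin_le (by linarith)

lemma Complex.log_one_sub_exp_two_mul_I {x : ℝ} (hx : x ∈ Set.Ioo 0 π) :
    Complex.log (1 - Complex.exp (2 * x * Complex.I))
      = Real.log (2 * Real.sin x) + (x - π / 2 : ℝ) * Complex.I := by
  have hs : 0 < 2 * Real.sin x := by have := Real.sin_pos_of_mem_Ioo hx; positivity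
  have h : 1 - Complex.exp (2 * x * Complex.I)
      = Complex.exp (Real.log (2 * Real.sin x) + (x - π / 2 : ℝ) * Complex.I) := by
    rw [Complex.exp_add, ← Complex.ofReal_exp, Real.exp_log hs, Complex.exp_mul_I,
      Complex.exp_mul_I, ← Complex.ofReal_cos, ← Complex.ofReal_sin, Real.cos_sub_pi_div_two,
      Real.sin_sub_pi_div_two, Complex.cos_two_mul, Complex.sin_two_mul]
    push_cast
    linear_combination -2 * Complex.sin_sq_add_cos_sq (x : ℂ)
  rw [h, Complex.log_exp] <;> simp <;> linarith [hx.1, hx.2, Real.pi_pos]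

/-- For `0 < x < π`, the real part of `tanhLog α` at `exp (2 * x * I)` is
`sinh (x / α) / (cosh (x / α) + cos (log (2 * sin x) / α))`. -/
noncomputable def tanhLog (α : ℝ) (z : ℂ) : ℂ :=
  Complex.tanh ((π / 2 - Complex.I * Complex.log (1 - z)) / (2 * α))

lemma tanhLog_arg_eq (α : ℝ) (z : ℂ) :
    (π / 2 - Complex.I * Complex.log (1 - z)) / (2 * α)
      = ((π / 2 + Complex.arg (1 - z)) / (2 * α) : ℝ)
        + (-Real.log ‖1 - z‖ / (2 * α) : ℝ) * Complex.I := by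
  conv_lhs => rw [← Complex.re_add_im (Complex.log (1 - z)), Complex.log_re, Complex.log_im]
  push_cast
  linear_combination (-Complex.arg (1 - z) / (2 * α) : ℂ) * Complex.I_sq

lemma re_tanhLog (α : ℝ) (z : ℂ) :
    (tanhLog α z).re = Real.sinh ((π / 2 + Complex.arg (1 - z)) / α)
      / (Real.cosh ((π / 2 + Complex.arg (1 - z)) / α) + Real.cos (Real.log ‖1 - z‖ / α)) := by
  rw [tanhLog, tanhLog_arg_eq, Complex.re_tanh_add_mul_I]
  have h (t : ℝ) : 2 * (t / (2 * α)) = t / α := by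
    rw [← mul_div_assoc, mul_div_mul_left _ _ two_ne_zero]
  rw [h, h, neg_div, Real.cos_neg]

lemma tanhLog_arg_re (α : ℝ) (z : ℂ) :
    ((π / 2 - Complex.I * Complex.log (1 - z)) / (2 * α)).re
      = (π / 2 + Complex.arg (1 - z)) / (2 * α) := by
  rw [tanhLog_arg_eq, Complex.add_re, Complex.ofReal_re, Complex.re_ofReal_mul, Complex.I_re,
    mul_zero, add_zero]

lemma tanhLog_arg_re_pos {α : ℝ} (hα : 0 < α) {z : ℂ} (hz : ‖z‖ ≤ 1) (h1 : z ≠ 1) :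
    0 < ((π / 2 - Complex.I * Complex.log (1 - z)) / (2 * α)).re := by
  have hn : 0 < ‖1 - z‖ := norm_pos_iff.2 (sub_ne_zero.2 h1.symm)
  have := (Complex.half_norm_le_pi_div_two_add_arg hz h1).1
  rw [tanhLog_arg_re]
  exact div_pos (by linarith) (by positivity)

lemma differentiableAt_tanhLog {α : ℝ} (hα : 0 < α) {z : ℂ} (hz : ‖z‖ ≤ 1) (h1 : z ≠ 1) :
    DifferentiableAt ℂ (tanhLog α) z := by
  have hs : 1 - z ∈ Complex.slitPlane := .inl (Complex.one_sub_re_pos hz h1)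
  have hc := Complex.cosh_ne_zero_of_re_pos (tanhLog_arg_re_pos hα hz h1)
  have hw : DifferentiableAt ℂ
      (fun z : ℂ ↦ (π / 2 - Complex.I * Complex.log (1 - z)) / (2 * α)) z := by
    fun_prop (disch := assumption)
  have : tanhLog α = fun z ↦ Complex.sinh ((π / 2 - Complex.I * Complex.log (1 - z)) / (2 * α))
      / Complex.cosh ((π / 2 - Complex.I * Complex.log (1 - z)) / (2 * α)) :=
    funext fun z ↦ Complex.tanh_eq_sinh_div_cosh _
  rw [this]
  exact hw.csinh.div hw.ccosh hc

lemma norm_one_sub_mul_tanhLog_le {α : ℝ} (hα : 0 < α) {z : ℂ} (hz : ‖z‖ ≤ 1) :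
    ‖(1 - z) * tanhLog α z‖ ≤ 4 * α * Real.cosh (π / (2 * α)) := by
  rcases eq_or_ne z 1 with rfl | h1
  · simp only [sub_self, zero_mul, norm_zero]; positivity
  obtain ⟨h2, h3⟩ := Complex.half_norm_le_pi_div_two_add_arg hz h1
  have hpos := tanhLog_arg_re_pos hα hz h1
  have h := Complex.norm_tanh_le hpos
  rw [tanhLog_arg_re] at h hpos
  have hn : 0 < ‖1 - z‖ := norm_pos_iff.2 (sub_ne_zero.2 h1.symm)
  rw [norm_mul]
  calc ‖1 - z‖ * ‖tanhLog α z‖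
      ≤ ‖1 - z‖ * (Real.cosh (π / (2 * α)) / (‖1 - z‖ / 2 / (2 * α))) := by
        refine mul_le_mul_of_nonneg_left (h.trans ?_) hn.le
        refine div_le_div₀ (Real.cosh_pos _).le ?_ (by positivity) (by gcongr)
        rw [Real.cosh_le_cosh, abs_of_pos hpos, abs_of_pos (by positivity)]
        gcongr
    _ = 4 * α * Real.cosh (π / (2 * α)) := by field_simp; ring

open Metric Topology Filter in
lemma diffContOnCl_sq_mul_tanhLog {α : ℝ} (hα : 0 < α) :
    DiffContOnCl ℂ (fun z ↦ (1 - z) ^ 2 * tanhLog α z) (ball 0 1) := by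
  have hd : ∀ z : ℂ, ‖z‖ ≤ 1 → z ≠ 1 →
      DifferentiableAt ℂ (fun z ↦ (1 - z) ^ 2 * tanhLog α z) z := fun z hz h1 ↦
    DifferentiableAt.mul (by fun_prop) (differentiableAt_tanhLog hα hz h1)
  constructor
  · intro z hz
    rw [mem_ball_zero_iff] at hz
    exact (hd z hz.le (by rintro rfl; simp at hz)).differentiableWithinAt
  · rw [closure_ball _ one_ne_zero]
    intro z hz
    rw [mem_closedBall_zero_iff] at hz
    rcases eq_or_ne z 1 with rfl | h1
    · have hlim : Tendsto (fun z : ℂ ↦ ‖1 - z‖ * (4 * α * Real.cosh (π / (2 * α))))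
          (𝓝[closedBall 0 1] 1) (𝓝 0) := by
        have : Continuous fun z : ℂ ↦ ‖1 - z‖ * (4 * α * Real.cosh (π / (2 * α))) := by fun_prop
        simpa using (this.tendsto 1).mono_left nhdsWithin_le_nhds
      rw [ContinuousWithinAt, sub_self, zero_pow two_ne_zero, zero_mul]
      refine squeeze_zero_norm' (eventually_nhdsWithin_of_forall fun z hz ↦ ?_) hlim
      rw [pow_two, mul_assoc, norm_mul]
      gcongr
      exact norm_one_sub_mul_tanhLog_le hα (mem_closedBall_zero_iff.1 hz)
    · exact (hd z hz h1).continuousAt.continuousWithinAt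

lemma Real.sinh_div_cosh_add_cos_nonneg {a : ℝ} (ha : 0 ≤ a) (b : ℝ) :
    0 ≤ Real.sinh a / (Real.cosh a + Real.cos b) :=
  div_nonneg (Real.sinh_nonneg_iff.2 ha) (by linarith [Real.one_le_cosh a, Real.neg_one_le_cos b])

open Topology Filter in
lemma tendsto_one_sub_mul_re_tanhLog {α : ℝ} (hα : 0 < α) :
    Tendsto (fun ρ : ℝ ↦ (1 - ρ) * (tanhLog α ρ).re) (𝓝[<] 1) (𝓝 0) := by
  set a := π / 2 / α with ha
  have hapos : 0 < a := by positivity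
  have hlim : Tendsto (fun ρ : ℝ ↦ (1 - ρ) * (Real.sinh a / (Real.cosh a - 1))) (𝓝[<] 1) (𝓝 0) := by
    have : Continuous fun ρ : ℝ ↦ (1 - ρ) * (Real.sinh a / (Real.cosh a - 1)) := by fun_prop
    simpa using (this.tendsto 1).mono_left nhdsWithin_le_nhds
  have hre : ∀ ρ : ℝ, ρ < 1 → (tanhLog α ρ).re
      = Real.sinh a / (Real.cosh a + Real.cos (Real.log ‖1 - (ρ : ℂ)‖ / α)) := by
    intro ρ hρ
    have : Complex.arg (1 - ρ) = 0 := by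
      exact_mod_cast Complex.arg_ofReal_of_nonneg (sub_nonneg.2 hρ.le)
    rw [re_tanhLog, this, add_zero]
  refine squeeze_zero' (eventually_nhdsWithin_of_forall fun ρ hρ ↦ ?_)
    (eventually_nhdsWithin_of_forall fun ρ hρ ↦ ?_) hlim
  · rw [hre ρ hρ]
    exact mul_nonneg (sub_nonneg.2 (Set.mem_Iio.1 hρ).le)
      (Real.sinh_div_cosh_add_cos_nonneg hapos.le _)
  · rw [hre ρ hρ]
    have h1 : 0 < Real.cosh a - 1 := sub_pos.2 (Real.one_lt_cosh.2 hapos.ne')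
    refine mul_le_mul_of_nonneg_left ?_ (sub_nonneg.2 (Set.mem_Iio.1 hρ).le)
    refine div_le_div_of_nonneg_left (Real.sinh_nonneg_iff.2 hapos.le) h1 ?_
    linarith [Real.neg_one_le_cos (Real.log ‖1 - (ρ : ℂ)‖ / α)]

lemma re_tanhLog_circleMap (α : ℝ) {x : ℝ} (hx : x ∈ Set.Ioo 0 π) :
    (tanhLog α (circleMap 0 1 (2 * x))).re
      = Real.sinh (x / α) / (Real.cosh (x / α) + Real.cos (Real.log (2 * Real.sin x) / α)) := by
  have h := Complex.log_one_sub_exp_two_mul_I hx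
  have hc : circleMap 0 1 (2 * x) = Complex.exp (2 * x * Complex.I) := by simp [circleMap]
  have h1 : Complex.arg (1 - circleMap 0 1 (2 * x)) = x - π / 2 := by
    rw [hc, ← Complex.log_im, h]; simp
  have h2 : Real.log ‖1 - circleMap 0 1 (2 * x)‖ = Real.log (2 * Real.sin x) := by
    rw [hc, ← Complex.log_re, h]; simp
  rw [re_tanhLog, h1, h2, add_sub_cancel]

lemma integral_sinh_div_cosh_add_cos_log_of_pos {α : ℝ} (hα : 0 < α) :
    ∫ x in (0:ℝ)..π,
        Real.sinh (x/α) / (Real.cosh (x/α) + Real.cos (Real.log (2 * Real.sin x) / α))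
      = π * Real.tanh (π/(4*α)) := by
  have hpos : ∀ z : ℂ, ‖z‖ = 1 → z ≠ 1 → 0 ≤ (tanhLog α z).re := by
    intro z hz h1
    rw [re_tanhLog]
    have := (Complex.half_norm_le_pi_div_two_add_arg hz.le h1).1
    exact Real.sinh_div_cosh_add_cos_nonneg
      (div_nonneg ((by positivity : 0 ≤ ‖1 - z‖ / 2).trans this) hα.le) _
  have key := integral_re_circleMap_of_nonneg (diffContOnCl_sq_mul_tanhLog hα) hpos
    (tendsto_one_sub_mul_re_tanhLog hα)
  have h0 : (tanhLog α 0).re = Real.tanh (π / (4 * α)) := by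
    have : ((π : ℂ) / 2 - Complex.I * Complex.log (1 - 0)) / (2 * α) = (π / (4 * α) : ℝ) := by
      simp; ring
    rw [tanhLog, this, ← Complex.ofReal_tanh, Complex.ofReal_re]
  have hsub := intervalIntegral.integral_comp_mul_left (a := 0) (b := π)
    (fun θ ↦ (tanhLog α (circleMap 0 1 θ)).re) (two_ne_zero' ℝ)
  rw [mul_zero, key, h0] at hsub
  calc _ = ∫ x in (0 : ℝ)..π, (tanhLog α (circleMap 0 1 (2 * x))).re := by
        rw [intervalIntegral.integral_of_le pi_pos.le, intervalIntegral.integral_of_le pi_pos.le,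
          MeasureTheory.integral_Ioc_eq_integral_Ioo, MeasureTheory.integral_Ioc_eq_integral_Ioo]
        exact MeasureTheory.setIntegral_congr_fun measurableSet_Ioo fun x hx ↦
          (re_tanhLog_circleMap α hx).symm
    _ = _ := by rw [hsub, smul_eq_mul]; ring

theorem stmt_16 (α : ℝ) (hα : α ≠ 0) :
    ∫ x in (0:ℝ)..π,
        Real.sinh (x/α) / (Real.cosh (x/α) + Real.cos (Real.log (2 * Real.sin x) / α))
      = π * Real.tanh (π/(4*α)) := by
  rcases hα.lt_or_gt with h | h
  · have := integral_sinh_div_cosh_add_cos_log_of_pos (neg_pos.2 h)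
    simpa only [div_neg, mul_neg, Real.sinh_neg, Real.cosh_neg, Real.cos_neg, Real.tanh_neg,
      neg_div, intervalIntegral.integral_neg, neg_inj] using this
  · exact integral_sinh_div_cosh_add_cos_log_of_pos h
end
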